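/- Let G be a finite nonabelian simple group in which every proper subgroup is abelian, and let H₁ and H₂ be two distinct maximal proper subgroups of G. Then H₁ ∩ H₂ is the trivial subgroup. -/

import Mathlib

/-- In a finite nonabelian simple group all of whose proper subgroups are abelian,
two distinct maximal proper subgroups intersect trivially. -/
theorem distinct_maximal_subgroups_intersect_trivially
    (G : Type*) [Group G] [Finite G] [IsSimpleGroup G]
    (hna : ¬ ∀ a b : G, a * b = b * a)
    (hab : ∀ H : Subgroup G, H ≠ ⊤ → ∀ a b : H, a * b = b * a)
    (H₁ H₂ : Subgroup G) (hmax₁ : IsCoatom H₁) (hmax₂ : IsCoatom H₂)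
    (hne : H₁ ≠ H₂) :
    H₁ ⊓ H₂ = ⊥ := by
  have h_le : ∀ H : Subgroup G, H ≠ ⊤ → ∀ K ≤ H, H ≤ Subgroup.centralizer K :=
    fun H hH K hK x hx ↦ Subgroup.mem_centralizer_iff.mpr fun y hy ↦
      congrArg Subtype.val (hab H hH ⟨y, hK hy⟩ ⟨x, hx⟩)
  have h_top : ⊤ ≤ Subgroup.centralizer ((H₁ ⊓ H₂ : Subgroup G) : Set G) := by
    rw [← hmax₁.sup_eq_top_of_ne hmax₂ hne]
    exact sup_le (h_le H₁ hmax₁.ne_top _ inf_le_left) (h_le H₂ hmax₂.ne_top _ inf_le_right)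
  have h_center : H₁ ⊓ H₂ ≤ Subgroup.center G := by
    rw [← Subgroup.centralizer_univ, ← Subgroup.coe_top]
    exact Subgroup.le_centralizer_iff.mp h_top
  rcases (inferInstance : (Subgroup.center G).Normal).eq_bot_or_eq_top with h | h
  · exact le_bot_iff.mp (h ▸ h_center)
  · exact absurd (fun a b ↦ (Subgroup.mem_center_iff.mp (h ▸ Subgroup.mem_top b) a)) hna
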